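/- arXiv:1810.02452 — 4 statements merged into one kernel-verified Lean document; each statement's English description precedes it below -/
import Mathlib

section
/- Let k ≥ 2, let G be a connected finite simple graph with at least two vertices, and let T be a k-leaf root of G. Then every edge of T lies on a path in T of length at most k whose two endpoints are leaves of T. -/
open SimpleGraph

/-- A vertex of a graph is a leaf if it has exactly one neighbor (degree 1). -/
def IsLeafVert {W : Type} (T : SimpleGraph W) (x : W) : Prop := ∃! y, T.Adj x y

/-- `T` is a `k`-leaf root of `G`, via the identification `ι` of the vertices of `G`
with the leaves of `T`. -/
def IsKLeafRoot {V W : Type} (G : SimpleGraph V) (T : SimpleGraph W) (ι : V ↪ W)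
    (k : ℕ) : Prop :=
  T.IsTree ∧ (∀ x : W, IsLeafVert T x ↔ ∃ v, ι v = x) ∧
    (∀ u v : V, u ≠ v → (G.Adj u v ↔ T.dist (ι u) (ι v) ≤ k))

theorem SimpleGraph.IsAcyclic.exists_isLeafVert_reachable_deleteEdges {W : Type} [Fintype W]
    {T : SimpleGraph W} (hT : T.IsAcyclic) {x y : W} (hxy : T.Adj x y) :
    ∃ z, IsLeafVert T z ∧ (T.deleteEdges {s(x, y)}).Reachable x z := by
  let lengths : Set ℕ := {n | ∃ (z : W) (p : T.Walk x z), p.IsPath ∧ y ∉ p.support ∧ p.length = n}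
  have hfin : lengths.Finite := by
    refine (Set.finite_lt_nat (Fintype.card W)).subset ?_
    rintro n ⟨z, p, hp, -, rfl⟩
    exact hp.length_lt
  have hne : lengths.Nonempty :=
    ⟨0, x, Walk.nil, Walk.IsPath.nil, by simpa using hxy.ne', rfl⟩
  obtain ⟨n, ⟨z, p, hp, hy, hn⟩, hmax⟩ := hfin.exists_maximal hne
  have hq : (Walk.cons hxy.symm p).IsPath := hp.cons hy
  refine ⟨z, ⟨(Walk.cons hxy.symm p).penultimate, ?_, fun w hw ↦ ?_⟩, ?_⟩
  · exact (Walk.adj_penultimate Walk.not_nil_cons).symm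
  · refine hT.eq_penultimate_of_adj_end hq hw ?_
    by_contra hws
    rw [Walk.support_cons, List.mem_cons, not_or] at hws
    have := hmax (y := n + 1)
      ⟨w, p.concat hw, hp.concat hws.2 hw, by simp [hy, Ne.symm hws.1], by simp [hn]⟩
      (Nat.le_succ n)
    lia
  · rw [reachable_deleteEdges_iff_exists_walk]
    exact ⟨p, fun h ↦ hy (p.snd_mem_support_of_mem_edges h)⟩

/-- Every edge of a `k`-leaf root of a connected graph on at least two vertices lies on a
path of length at most `k` between two leaves. -/
theorem stmt0 {V W : Type} [Fintype V] [Fintype W] (k : ℕ) (hk : 2 ≤ k)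
    (G : SimpleGraph V) (hG : G.Connected) (hV : 2 ≤ Fintype.card V)
    (T : SimpleGraph W) (ι : V ↪ W) (hroot : IsKLeafRoot G T ι k) :
    ∀ e ∈ T.edgeSet, ∃ (a b : W) (p : T.Walk a b),
      IsLeafVert T a ∧ IsLeafVert T b ∧ p.IsPath ∧ p.length ≤ k ∧ e ∈ p.edges := by
  obtain ⟨hT, hleaf, hadj⟩ := hroot
  intro e he
  induction e with | _ x y
  obtain ⟨a, ha, hxa⟩ := hT.isAcyclic.exists_isLeafVert_reachable_deleteEdges he
  obtain ⟨b, hb, hyb⟩ := hT.isAcyclic.exists_isLeafVert_reachable_deleteEdges he.symm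
  rw [Sym2.eq_swap] at hyb
  have hbridge : ¬ (T.deleteEdges {s(x, y)}).Reachable x y :=
    isBridge_iff.mp (isAcyclic_iff_forall_isBridge.mp hT.isAcyclic he)
  obtain ⟨u, rfl⟩ := (hleaf a).mp ha
  obtain ⟨v, rfl⟩ := (hleaf b).mp hb
  obtain ⟨q⟩ := hG u v
  obtain ⟨d, -, hfst, hsnd⟩ := q.exists_boundary_dart
    {w | (T.deleteEdges {s(x, y)}).Reachable x (ι w)} hxa
    (fun h ↦ hbridge (h.trans hyb.symm))
  obtain ⟨p, hp, hlen⟩ := hT.connected.exists_path_of_dist (ι d.fst) (ι d.snd)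
  refine ⟨_, _, p, (hleaf _).mpr ⟨_, rfl⟩, (hleaf _).mpr ⟨_, rfl⟩, hp,
    hlen.trans_le ((hadj _ _ d.adj.ne).mp d.adj), ?_⟩
  by_contra hep
  exact hsnd (hfst.trans (p.toDeleteEdge _ hep).reachable)
end

section
/- Let k ≥ 2, let G be a connected finite simple graph with at least two vertices, and let T be a k-leaf root of G. Then every vertex of T is at distance at most k − 1 from some leaf of T. -/
open SimpleGraph

/-- In an acyclic graph, a walk between two distinct neighbors of `x` passes through `x`. -/
lemma mem_support_of_adj_of_adj {W : Type} {T : SimpleGraph W} (hT : T.IsAcyclic)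
    {x y z : W} (hy : T.Adj x y) (hz : T.Adj x z) (hyz : y ≠ z) (p : T.Walk y z) :
    x ∈ p.support := by
  by_contra hx
  have hb := isAcyclic_iff_forall_isBridge.1 hT ((T.mem_edgeSet).2 hy)
  have hmem := isBridge_iff_forall_walk_mem_edges.1 hb (Walk.cons hz p.reverse)
  simp only [Walk.edges_cons, List.mem_cons, Walk.edges_reverse, List.mem_reverse] at hmem
  rcases hmem with h | h
  · exact hyz (Sym2.congr_right.1 h)
  · exact hx (p.fst_mem_support_of_mem_edges h)

/-- In a connected graph, two vertices closer to each other than the sum of their distances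
to `x` are joined by a walk avoiding `x`. -/
lemma exists_walk_notMem_support {W : Type} {T : SimpleGraph W} (hT : T.Connected)
    {x u v : W} (h : T.dist u v < T.dist x u + T.dist x v) :
    ∃ p : T.Walk u v, x ∉ p.support := by
  classical
  obtain ⟨p, hp⟩ := hT.exists_walk_length_eq_dist u v
  refine ⟨p, fun hx => ?_⟩
  have hlen := congrArg Walk.length (p.take_spec hx)
  rw [Walk.length_append] at hlen
  have h₁ := dist_le (p.takeUntil x hx)
  have h₂ := dist_le (p.dropUntil x hx)
  rw [dist_comm] at h₁
  omega

/-- In a finite tree, every branch at `x` contains a leaf. -/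
lemma exists_isLeafVert_walk_notMem_support {W : Type} [Fintype W] {T : SimpleGraph W}
    (hT : T.IsTree) {x y : W} (hy : T.Adj x y) :
    ∃ u, IsLeafVert T u ∧ ∃ p : T.Walk y u, x ∉ p.support := by
  obtain ⟨u, ⟨p, hp⟩, hmax⟩ := Set.exists_max_image
    {u | ∃ p : T.Walk y u, x ∉ p.support} (T.dist x) (Set.toFinite _)
    ⟨y, Walk.nil, by simpa using hy.ne⟩
  have hux : u ≠ x := fun h => hp (h ▸ p.end_mem_support)
  have hle : ∀ z, T.Adj u z → T.dist x z ≤ T.dist x u := by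
    intro z hz
    by_cases hzx : z = x
    · simp [hzx]
    · refine hmax z ⟨p.concat hz, ?_⟩
      simpa [Walk.support_concat, hp] using Ne.symm hzx
  have hwalk : ∀ z, T.Adj u z → ∃ q : T.Walk z x, u ∉ q.support := by
    intro z hz
    apply exists_walk_notMem_support hT.connected
    have h₁ := hle z hz
    have h₂ : T.dist u z = 1 := dist_eq_one_iff_adj.2 hz
    rw [dist_comm (u := z), dist_comm (u := u) (v := x)]
    omega
  have : Nontrivial W := ⟨u, x, hux⟩
  obtain ⟨z, hz⟩ := hT.connected.preconnected.exists_adj_of_nontrivial u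
  refine ⟨u, ⟨z, hz, fun w hw => ?_⟩, p, hp⟩
  by_contra hwz
  obtain ⟨q, hq⟩ := hwalk w hw
  obtain ⟨r, hr⟩ := hwalk z hz
  have := mem_support_of_adj_of_adj hT.isAcyclic hw hz hwz (q.append r.reverse)
  simp [Walk.mem_support_append_iff, hq, hr] at this

/-- Every vertex of a `k`-leaf root of a connected graph on at least two vertices is at
distance at most `k - 1` from some leaf. -/
theorem stmt1 {V W : Type} [Fintype V] [Fintype W] (k : ℕ) (hk : 2 ≤ k)
    (G : SimpleGraph V) (hG : G.Connected) (hV : 2 ≤ Fintype.card V)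
    (T : SimpleGraph W) (ι : V ↪ W) (hroot : IsKLeafRoot G T ι k) :
    ∀ x : W, ∃ ℓ : W, IsLeafVert T ℓ ∧ T.dist x ℓ ≤ k - 1 := by
  obtain ⟨hT, hleaf, hadj⟩ := hroot
  intro x
  by_contra! hfar
  have hι : ∀ v, k ≤ T.dist x (ι v) := fun v => by
    have := hfar _ ((hleaf _).2 ⟨v, rfl⟩)
    omega
  have hwalk : ∀ u v, G.Walk u v → ∃ p : T.Walk (ι u) (ι v), x ∉ p.support := by
    intro u v w
    induction w with
    | nil =>
      rename_i u
      refine ⟨Walk.nil, ?_⟩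
      have := hι u
      rw [Walk.support_nil, List.mem_singleton]
      rintro rfl
      rw [dist_self] at this
      omega
    | @cons u v w h _ ih =>
      obtain ⟨q, hq⟩ := ih
      have h₁ := (hadj u v h.ne).1 h
      have h₂ := hι u
      have h₃ := hι v
      obtain ⟨p, hp⟩ := exists_walk_notMem_support hT.connected
        (show T.dist (ι u) (ι v) < T.dist x (ι u) + T.dist x (ι v) by omega)
      exact ⟨p.append q, by simp [Walk.mem_support_append_iff, hp, hq]⟩
  have : Nontrivial V := Fintype.one_lt_card_iff_nontrivial.1 hV
  have : Nontrivial W := ι.injective.nontrivial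
  obtain ⟨y, hy⟩ := hT.connected.preconnected.exists_adj_of_nontrivial x
  have hx : ¬ IsLeafVert T x := fun h => by
    have := hfar x h
    rw [dist_self] at this
    omega
  obtain ⟨z, hz, hzy⟩ : ∃ z, T.Adj x z ∧ z ≠ y := by
    by_contra! h
    exact hx ⟨y, hy, h⟩
  obtain ⟨a, ha, p, hp⟩ := exists_isLeafVert_walk_notMem_support hT hy
  obtain ⟨b, hb, q, hq⟩ := exists_isLeafVert_walk_notMem_support hT hz
  obtain ⟨u, rfl⟩ := (hleaf a).1 ha
  obtain ⟨v, rfl⟩ := (hleaf b).1 hb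
  obtain ⟨w⟩ := hG.preconnected u v
  obtain ⟨r, hr⟩ := hwalk u v w
  have := mem_support_of_adj_of_adj hT.isAcyclic hy hz hzy.symm
    (p.append (r.append q.reverse))
  simp [Walk.mem_support_append_iff, hp, hq, hr] at this
end

section
/- Let k ≥ 2, let G be a connected finite simple graph with at least two vertices, let T be a k-leaf root of G, and let f be a function from the vertices of T to the leaves of T such that f(ℓ) = ℓ for every leaf ℓ and such that for every vertex v the leaf f(v) is at minimum distance from v among all leaves of T. Then for every edge u₁u₂ of T with f(u₁) ≠ f(u₂), the vertices f(u₁) and f(u₂) (which are vertices of G) are adjacent in G. -/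
open SimpleGraph

namespace SimpleGraph

variable {W : Type*} {T : SimpleGraph W}

/-- Through a vertex of a shortest walk, the triangle inequality is an equality. -/
theorem Walk.dist_add_dist_of_mem_support {x y z : W} {p : T.Walk x y}
    (hp : p.length = T.dist x y) (hz : z ∈ p.support) :
    T.dist x z + T.dist z y = T.dist x y := by
  classical
  have hlen := congrArg Walk.length (p.take_spec hz)
  rw [Walk.length_append] at hlen
  have h₁ := dist_le (p.takeUntil z hz)
  have h₂ := dist_le (p.dropUntil z hz)
  have h₃ := (p.takeUntil z hz).reachable.dist_triangle_left y
  omega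

/-- In an acyclic graph, every path is a shortest walk. -/
theorem IsAcyclic.length_eq_dist_of_isPath (hT : T.IsAcyclic) {x y : W} {p : T.Walk x y}
    (hp : p.IsPath) : p.length = T.dist x y := by
  obtain ⟨q, hq, hlen⟩ := p.reachable.exists_path_of_dist
  have h : p = q :=
    congrArg Subtype.val ((hT.subsingleton_path x y).elim ⟨p, hp⟩ ⟨q, hq⟩)
  rw [h, hlen]

/-- In a tree, the path between vertices on different sides of an edge uses this edge. -/
theorem IsTree.dist_eq_of_dist_lt_of_dist_lt (hT : T.IsTree) {u v x y : W} (huv : T.Adj u v)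
    (hx : T.dist x u < T.dist x v) (hy : T.dist y v < T.dist y u) :
    T.dist x y = T.dist x u + 1 + T.dist v y := by
  obtain ⟨p, hp, hpl⟩ := hT.connected.exists_path_of_dist x u
  obtain ⟨q, hq, hql⟩ := hT.connected.exists_path_of_dist v y
  have hpath : (p.append (Walk.cons huv q)).IsPath := by
    rw [Walk.isPath_def, Walk.support_append, Walk.support_cons, List.tail_cons,
      List.nodup_append']
    refine ⟨hp.support_nodup, hq.support_nodup, fun z hzp hzq => ?_⟩
    have h₁ := Walk.dist_add_dist_of_mem_support hpl hzp
    have h₂ := Walk.dist_add_dist_of_mem_support hql hzq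
    have h₃ := hT.connected.dist_triangle (u := x) (v := z) (w := v)
    have h₄ := hT.connected.dist_triangle (u := u) (v := z) (w := y)
    rw [T.dist_comm (u := z) (v := v)] at h₃
    rw [T.dist_comm (u := u) (v := z)] at h₄
    rw [T.dist_comm (u := y) (v := v), T.dist_comm (u := y) (v := u)] at hy
    omega
  rw [← hT.isAcyclic.length_eq_dist_of_isPath hpath, Walk.length_append, Walk.length_cons,
    hpl, hql]
  omega

end SimpleGraph

/-- In a finite tree, each side of an edge contains a leaf. -/
theorem SimpleGraph.IsTree.exists_isLeafVert_dist_lt {W : Type} [Finite W] {T : SimpleGraph W}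
    (hT : T.IsTree) {u v : W} (huv : T.Adj u v) :
    ∃ x, IsLeafVert T x ∧ T.dist x u < T.dist x v := by
  obtain ⟨x, hx, hmax⟩ := Set.exists_max_image {x | T.dist x u < T.dist x v}
    (fun x => T.dist v x) (Set.toFinite _) ⟨u, by simp [dist_eq_one_iff_adj.mpr huv]⟩
  rw [Set.mem_ofPred_eq] at hx
  have hcloser : ∀ y, T.Adj x y → T.dist v x = T.dist v y + 1 := by
    intro y hxy
    refine (hT.dist_eq_dist_add_one_of_adj v hxy).resolve_right fun hvy => ?_
    have h₁ := hT.dist_eq_dist_add_one_of_adj u hxy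
    have hy : T.dist y u < T.dist y v := by
      rw [T.dist_comm (u := y) (v := u), T.dist_comm (u := y) (v := v)]
      rw [T.dist_comm (u := x) (v := u), T.dist_comm (u := x) (v := v)] at hx
      omega
    have h₂ := hmax y hy
    omega
  have : Nontrivial W := ⟨u, v, huv.ne⟩
  obtain ⟨y, hxy⟩ := hT.connected.preconnected.exists_adj_of_nontrivial x
  refine ⟨x, ⟨y, hxy, fun z hxz => ?_⟩, hx⟩
  by_contra hzy
  have hzx : T.dist z x = 1 := dist_eq_one_iff_adj.mpr hxz.symm
  have h₀ : T.dist z y ≠ 0 := fun h => hzy (hT.connected.dist_eq_zero_iff.mp h)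
  have h₁ := hT.dist_eq_dist_add_one_of_adj z hxy
  have h₂ := hcloser y hxy
  have h₃ := hcloser z hxz
  have h₄ := hT.dist_eq_of_dist_lt_of_dist_lt (x := v) (y := z) hxy.symm (by omega) (by omega)
  omega

/-- If each vertex of a `k`-leaf root `T` of a connected graph `G` is labeled by a nearest
leaf of `T` (each leaf being labeled by itself), then the endpoints of any edge of `T`
with differently labeled endpoints correspond to adjacent vertices of `G`. -/
theorem stmt3 {V W : Type} [Fintype V] [Fintype W] (k : ℕ) (hk : 2 ≤ k)
    (G : SimpleGraph V) (hG : G.Connected) (hV : 2 ≤ Fintype.card V)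
    (T : SimpleGraph W) (ι : V ↪ W) (hroot : IsKLeafRoot G T ι k)
    (f : W → W) (hf1 : ∀ x : W, IsLeafVert T (f x))
    (hf2 : ∀ ℓ : W, IsLeafVert T ℓ → f ℓ = ℓ)
    (hf3 : ∀ v ℓ : W, IsLeafVert T ℓ → T.dist v (f v) ≤ T.dist v ℓ) :
    ∀ u₁ u₂ : W, T.Adj u₁ u₂ → f u₁ ≠ f u₂ →
      ∀ v₁ v₂ : V, ι v₁ = f u₁ → ι v₂ = f u₂ → G.Adj v₁ v₂ := by
  intro u₁ u₂ hu hne v₁ v₂ hv₁ hv₂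
  obtain ⟨hT, hleaf, hadj⟩ := hroot
  obtain ⟨x, hxl, hx⟩ := hT.exists_isLeafVert_dist_lt hu
  obtain ⟨y, hyl, hy⟩ := hT.exists_isLeafVert_dist_lt hu.symm
  obtain ⟨a, rfl⟩ := (hleaf x).mp hxl
  obtain ⟨b, rfl⟩ := (hleaf y).mp hyl
  obtain ⟨p⟩ := hG.preconnected a b
  obtain ⟨d, -, hd₁, hd₂⟩ := p.exists_boundary_dart
    {w | T.dist (ι w) u₁ < T.dist (ι w) u₂} hx hy.not_gt
  rw [Set.mem_ofPred_eq] at hd₁ hd₂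
  have hd₃ : T.dist (ι d.snd) u₂ < T.dist (ι d.snd) u₁ :=
    lt_of_le_of_ne (not_lt.mp hd₂) (hT.dist_ne_of_adj (ι d.snd) hu).symm
  have hk' := (hadj d.fst d.snd d.adj.ne).mp d.adj
  rw [hT.dist_eq_of_dist_lt_of_dist_lt hu hd₁ hd₃] at hk'
  have h₁ := hf3 u₁ (ι d.fst) ((hleaf _).mpr ⟨_, rfl⟩)
  have h₂ := hf3 u₂ (ι d.snd) ((hleaf _).mpr ⟨_, rfl⟩)
  have hv : v₁ ≠ v₂ := fun h => hne (by rw [← hv₁, ← hv₂, h])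
  rw [hadj v₁ v₂ hv, hv₁, hv₂]
  have h₃ := hT.connected.dist_triangle (u := f u₁) (v := u₁) (w := f u₂)
  have h₄ := hT.connected.dist_triangle (u := u₁) (v := u₂) (w := f u₂)
  rw [dist_eq_one_iff_adj.mpr hu] at h₄
  rw [T.dist_comm (u := f u₁) (v := u₁)] at h₃
  rw [T.dist_comm (u := ι d.fst) (v := u₁)] at hk'
  omega
end

section
/- Let k ≥ 2 and let G be a finite simple graph with at least two vertices. If G is a k-leaf power, then G is also a (k+2)-leaf power. -/
open SimpleGraph

/-- `G` is a `k`-leaf power: it has a `k`-leaf root. -/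
def IsKLeafPower {V : Type} (G : SimpleGraph V) (k : ℕ) : Prop :=
  ∃ (W : Type) (_ : Fintype W) (T : SimpleGraph W) (ι : V ↪ W), IsKLeafRoot G T ι k

/-- The graph obtained from `T` by attaching one new vertex `inr v` to `ι v` for each `v`. -/
def attachPendants {V W : Type} (T : SimpleGraph W) (ι : V ↪ W) : SimpleGraph (W ⊕ V) where
  Adj
    | .inl a, .inl b => T.Adj a b
    | .inl a, .inr v => a = ι v
    | .inr v, .inl a => a = ι v
    | .inr _, .inr _ => False
  symm := ⟨by rintro (a | a) (b | b) h <;> first | exact h.symm | exact h⟩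
  loopless := ⟨by rintro (a | a) h <;> first | exact T.loopless.irrefl a h | exact h⟩

section attachPendants

variable {V W : Type} {T : SimpleGraph W} {ι : V ↪ W}

@[simp] lemma attachPendants_adj_inl_inl {a b : W} :
    (attachPendants T ι).Adj (.inl a) (.inl b) ↔ T.Adj a b := Iff.rfl

@[simp] lemma attachPendants_adj_inl_inr {a : W} {v : V} :
    (attachPendants T ι).Adj (.inl a) (.inr v) ↔ a = ι v := Iff.rfl

@[simp] lemma attachPendants_adj_inr_inl {a : W} {v : V} :
    (attachPendants T ι).Adj (.inr v) (.inl a) ↔ a = ι v := Iff.rfl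

@[simp] lemma attachPendants_adj_inr_inr {u v : V} :
    ¬ (attachPendants T ι).Adj (.inr u) (.inr v) := id

/-- The inclusion of `T` into `attachPendants T ι`. -/
def attachPendantsHom (T : SimpleGraph W) (ι : V ↪ W) : T →g attachPendants T ι where
  toFun := .inl
  map_rel' h := h

/-- A map that sends each edge to an edge or to a single vertex does not lengthen walks. -/
lemma exists_walk_length_le_of_weak_hom {X Y : Type} {G : SimpleGraph X} {H : SimpleGraph Y}
    (f : X → Y) (hf : ∀ x y, G.Adj x y → f x = f y ∨ H.Adj (f x) (f y)) {x y : X}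
    (p : G.Walk x y) : ∃ q : H.Walk (f x) (f y), q.length ≤ p.length := by
  induction p with
  | nil => exact ⟨.nil, le_rfl⟩
  | @cons a b c h p ih =>
    obtain ⟨q, hq⟩ := ih
    rcases hf _ _ h with h' | h'
    · exact ⟨q.copy h'.symm rfl, by simp; omega⟩
    · exact ⟨.cons h' q, by simpa using hq⟩

lemma attachPendants_weak_hom (x y : W ⊕ V) (h : (attachPendants T ι).Adj x y) :
    Sum.elim id ι x = Sum.elim id ι y ∨ T.Adj (Sum.elim id ι x) (Sum.elim id ι y) := by
  rcases x with a | u <;> rcases y with b | v <;> simp_all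

lemma attachPendants_connected (hT : T.Connected) : (attachPendants T ι).Connected := by
  obtain ⟨w⟩ := hT.nonempty
  refine (connected_iff_exists_forall_reachable _).2 ⟨.inl w, ?_⟩
  rintro (a | v)
  · exact (hT.preconnected w a).map (attachPendantsHom T ι)
  · refine ((hT.preconnected w (ι v)).map (attachPendantsHom T ι)).trans (Adj.reachable ?_)
    exact (rfl : ι v = ι v)

lemma attachPendants_isAcyclic (hT : T.IsAcyclic) : (attachPendants T ι).IsAcyclic := by
  rw [isAcyclic_iff_forall_adj_isBridge] at hT ⊢
  have pendant : ∀ v, (attachPendants T ι).IsBridge s(.inl (ι v), .inr v) := by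
    intro v
    rw [isBridge_iff]
    refine not_reachable_of_neighborSet_right_eq_empty (by simp) ?_
    ext x
    rcases x with a | u <;> simp
  rintro (a | u) (b | v) h
  · have hab := hT h
    rw [isBridge_iff] at hab ⊢
    rintro ⟨p⟩
    refine hab (exists_walk_length_le_of_weak_hom (Sum.elim id ι) ?_ p).choose.reachable
    rintro (c | c) (d | d) hcd <;> simp_all
  · obtain rfl : a = ι v := h
    exact pendant v
  · obtain rfl : b = ι u := h
    rw [Sym2.eq_swap]
    exact pendant u
  · exact h.elim

lemma attachPendants_dist_inr (hT : T.Connected) {u v : V} (huv : u ≠ v) :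
    (attachPendants T ι).dist (.inr u) (.inr v) = T.dist (ι u) (ι v) + 2 := by
  apply le_antisymm
  · obtain ⟨p, hp⟩ := hT.exists_walk_length_eq_dist (ι u) (ι v)
    have hu : (attachPendants T ι).Adj (.inr u) (attachPendantsHom T ι (ι u)) :=
      (rfl : ι u = ι u)
    have hv : (attachPendants T ι).Adj (attachPendantsHom T ι (ι v)) (.inr v) :=
      (rfl : ι v = ι v)
    refine (dist_le (.cons hu ((p.map (attachPendantsHom T ι)).concat hv))).trans ?_
    simp [hp]
  · obtain ⟨p, hp⟩ :=
      (attachPendants_connected (ι := ι) hT).exists_walk_length_eq_dist (.inr u) (.inr v)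
    rw [← hp]
    cases p with
    | nil => exact absurd rfl huv
    | @cons _ x _ h q =>
      rcases x with a | w
      · obtain rfl := attachPendants_adj_inr_inl.1 h
        rw [Walk.length_cons, ← Walk.length_reverse]
        cases q.reverse with
        | @cons _ y _ h' r =>
          rcases y with b | w
          · obtain rfl := attachPendants_adj_inr_inl.1 h'
            obtain ⟨s, hs⟩ :=
              exists_walk_length_le_of_weak_hom (Sum.elim id ι) attachPendants_weak_hom r
            have hr : T.dist (ι v) (ι u) ≤ r.length := (dist_le s).trans hs
            rw [dist_comm] at hr
            rw [Walk.length_cons]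
            omega
          · exact h'.elim
      · exact h.elim

lemma isLeafVert_attachPendants (hι : ∀ x, IsLeafVert T x ↔ ∃ v, ι v = x) (x : W ⊕ V) :
    IsLeafVert (attachPendants T ι) x ↔ ∃ v, Sum.inr v = x := by
  constructor
  · rintro ⟨y, hy, huniq⟩
    rcases x with a | v
    · exfalso
      by_cases ha : ∃ v, ι v = a
      · obtain ⟨z, hz, -⟩ := (hι a).2 ha
        obtain ⟨v, rfl⟩ := ha
        have hl := huniq (.inl z) hz
        have hr := huniq (.inr v) (rfl : ι v = ι v)
        simp [← hl] at hr
      · rcases y with b | v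
        · exact ha ((hι a).1 ⟨b, hy, fun z hz => Sum.inl_injective (huniq (.inl z) hz)⟩)
        · exact ha ⟨v, Eq.symm hy⟩
    · exact ⟨v, rfl⟩
  · rintro ⟨v, rfl⟩
    refine ⟨.inl (ι v), (rfl : ι v = ι v), ?_⟩
    rintro (a | w) h
    · exact congrArg Sum.inl h
    · exact h.elim

end attachPendants

/-- Every `k`-leaf power on at least two vertices is also a `(k + 2)`-leaf power. -/
theorem stmt12 {V : Type} [Fintype V] (k : ℕ) (hk : 2 ≤ k)
    (G : SimpleGraph V) (hV : 2 ≤ Fintype.card V)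
    (h : IsKLeafPower G k) : IsKLeafPower G (k + 2) := by
  obtain ⟨W, _, T, ι, hT, hleaf, hadj⟩ := h
  refine ⟨W ⊕ V, inferInstance, attachPendants T ι, .inr,
    ⟨attachPendants_connected hT.connected, attachPendants_isAcyclic hT.isAcyclic⟩,
    isLeafVert_attachPendants hleaf, fun u v huv => ?_⟩
  rw [hadj u v huv, Function.Embedding.inr_apply, Function.Embedding.inr_apply,
    attachPendants_dist_inr hT.connected huv]
  omega
end
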